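/- Let ℒ be a bounded distributive abstract logic with space X = PTh and base Λ(X) = { a^X : a ∈ Expr }, and define τ : Expr → Λ(X) by τ(a) = a^X. Then: (1) two expressions a, b are logically equivalent in ℒ if and only if a^X = b^X; (2) { τ⁻¹(F) : F a prime filter on Λ(X) } equals the set PTh of prime theories of ℒ. Consequently, letting ℒ' be the abstract logic on Λ(X) whose theories are the nonempty intersections of prime filters on Λ(X), τ is a normal and stable logic map from ℒ to ℒ' which is surjective onto Λ(X); i.e., τ is a logic isomorphism between ℒ and ℒ'. -/

import Mathlib

/-- An abstract logic: a nonempty family of theories on `Expr`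
closed under intersections of nonempty subfamilies. -/
def IsAbstractLogic {Expr : Type*} (Th : Set (Set Expr)) : Prop :=
  Th.Nonempty ∧ ∀ 𝒯 ⊆ Th, 𝒯.Nonempty → ⋂₀ 𝒯 ∈ Th

/-- The logic is closed under chains: the union of every nonempty chain of
theories is a theory. -/
def ChainClosed {Expr : Type*} (Th : Set (Set Expr)) : Prop :=
  ∀ 𝒯 ⊆ Th, 𝒯.Nonempty → IsChain (· ⊆ ·) 𝒯 → ⋃₀ 𝒯 ∈ Th

/-- A theory is totally prime if whenever it is the intersection of a nonempty
family of theories, it belongs to that family. -/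
def TotallyPrimeTheory {Expr : Type*} (Th : Set (Set Expr)) (T : Set Expr) : Prop :=
  T ∈ Th ∧ ∀ 𝒯 ⊆ Th, 𝒯.Nonempty → T = ⋂₀ 𝒯 → T ∈ 𝒯

/-- A theory is prime if whenever it is the intersection of two theories,
it equals one of them. -/
def PrimeTheory {Expr : Type*} (Th : Set (Set Expr)) (T : Set Expr) : Prop :=
  T ∈ Th ∧ ∀ T₁ ∈ Th, ∀ T₂ ∈ Th, T = T₁ ∩ T₂ → T = T₁ ∨ T = T₂

/-- A distributive abstract logic: an abstract logic closed under chains with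
binary operations `vee` (disjunction) and `wedge` (conjunction) behaving as
expected on all totally prime theories. -/
def IsDistributiveLogic {Expr : Type*} (Th : Set (Set Expr))
    (vee wedge : Expr → Expr → Expr) : Prop :=
  IsAbstractLogic Th ∧ ChainClosed Th ∧
  (∀ T, TotallyPrimeTheory Th T → ∀ a b, vee a b ∈ T ↔ (a ∈ T ∨ b ∈ T)) ∧
  (∀ T, TotallyPrimeTheory Th T → ∀ a b, wedge a b ∈ T ↔ (a ∈ T ∧ b ∈ T))

/-- The space of a distributive abstract logic: the set of its prime theories. -/
structure LogicSpace {Expr : Type*} (Th : Set (Set Expr)) where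
  val : Set Expr
  prime : PrimeTheory Th val

/-- The basic open set `a^X = { P ∈ PTh | a ∈ P }`. -/
def basicSet {Expr : Type*} (Th : Set (Set Expr)) (a : Expr) : Set (LogicSpace Th) :=
  {P | a ∈ P.val}

/-- The topology on the space of prime theories generated by the base
`Λ(X) = { a^X | a ∈ Expr }`. -/
instance {Expr : Type*} (Th : Set (Set Expr)) : TopologicalSpace (LogicSpace Th) :=
  TopologicalSpace.generateFrom (Set.range (basicSet Th))

/-- A prime filter on a family `Λ` of subsets (closed under binary unions and
intersections): a nonempty subset of `Λ` not containing `∅`, upward closed in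
`(Λ, ⊆)`, closed under binary intersections, and prime for binary unions. -/
def IsPrimeFilter {X : Type*} (Λ : Set (Set X)) (F : Set (Set X)) : Prop :=
  F.Nonempty ∧ F ⊆ Λ ∧ ∅ ∉ F ∧
  (∀ U ∈ F, ∀ V ∈ Λ, U ⊆ V → V ∈ F) ∧
  (∀ U ∈ F, ∀ V ∈ F, U ∩ V ∈ F) ∧
  (∀ U ∈ Λ, ∀ V ∈ Λ, U ∪ V ∈ F → U ∈ F ∨ V ∈ F)

/-- A distributive space: a T₀ space with a base `Λ` of compact open sets such
that `Λ ∪ {∅}` contains every compact open, `Λ` is closed under binary unions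
and intersections, and every prime filter on `Λ` is of the form
`x^Λ = { U ∈ Λ | x ∈ U }` for some point `x`. -/
def IsDistributiveSpace (X : Type*) [TopologicalSpace X] (Λ : Set (Set X)) : Prop :=
  T0Space X ∧ TopologicalSpace.IsTopologicalBasis Λ ∧
  (∀ U ∈ Λ, IsCompact U) ∧
  (∀ U : Set X, IsOpen U → IsCompact U → U ∈ Λ ∪ {∅}) ∧
  (∀ U ∈ Λ, ∀ V ∈ Λ, U ∪ V ∈ Λ) ∧
  (∀ U ∈ Λ, ∀ V ∈ Λ, U ∩ V ∈ Λ) ∧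
  (∀ F, IsPrimeFilter Λ F → ∃ x : X, F = {U ∈ Λ | x ∈ U})

/-- A bounded distributive space additionally has `∅ ∈ Λ` and `X ∈ Λ`. -/
def IsBoundedDistributiveSpace (X : Type*) [TopologicalSpace X] (Λ : Set (Set X)) : Prop :=
  IsDistributiveSpace X Λ ∧ ∅ ∈ Λ ∧ Set.univ ∈ Λ

/-- Logical equivalence: two expressions belong to exactly the same theories. -/
def LogEquiv {Expr : Type*} (Th : Set (Set Expr)) (a b : Expr) : Prop :=
  ∀ T ∈ Th, (a ∈ T ↔ b ∈ T)

/-- The theories of the abstract logic `ℒ'` on `Λ(X)`: the nonempty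
intersections of prime filters on `Λ(X)`. -/
def primeFilterTheories {Expr : Type*} (Th : Set (Set Expr)) :
    Set (Set (Set (LogicSpace Th))) :=
  {T | ∃ 𝒬 : Set (Set (Set (LogicSpace Th))), 𝒬.Nonempty ∧
        (∀ F ∈ 𝒬, IsPrimeFilter (Set.range (basicSet Th)) F) ∧ T = ⋂₀ 𝒬}

section

variable {Expr : Type*} {Th : Set (Set Expr)} {vee wedge : Expr → Expr → Expr}

theorem TotallyPrimeTheory.primeTheory {T : Set Expr} (hT : TotallyPrimeTheory Th T) :
    PrimeTheory Th T := by
  refine ⟨hT.1, fun T₁ h₁ T₂ h₂ h => ?_⟩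
  simpa using hT.2 {T₁, T₂} (by rintro T (rfl | rfl) <;> assumption) ⟨T₁, by simp⟩
    (by simpa using h)

/-- The Zorn lemma for a property of theories preserved by unions of nonempty chains. -/
theorem ChainClosed.exists_maximal (hC : ChainClosed Th) (p : Set Expr → Prop)
    (hp : ∀ 𝒞 ⊆ {T | T ∈ Th ∧ p T}, 𝒞.Nonempty → IsChain (· ⊆ ·) 𝒞 → p (⋃₀ 𝒞))
    {T : Set Expr} (hT : T ∈ Th) (hpT : p T) :
    ∃ M, T ⊆ M ∧ M ∈ Th ∧ p M ∧ ∀ N ∈ Th, p N → M ⊆ N → M = N := by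
  obtain ⟨M, hTM, hM⟩ := zorn_subset_nonempty {T | T ∈ Th ∧ p T}
    (fun 𝒞 h𝒞 hc hne => ⟨⋃₀ 𝒞, ⟨hC 𝒞 (fun U hU => (h𝒞 hU).1) hne hc, hp 𝒞 h𝒞 hne hc⟩,
      fun U hU => Set.subset_sUnion_of_mem hU⟩) T ⟨hT, hpT⟩
  exact ⟨M, hTM, hM.prop.1, hM.prop.2, fun N hN hpN h => hM.eq_of_subset ⟨hN, hpN⟩ h⟩

theorem ChainClosed.exists_totallyPrimeTheory (hC : ChainClosed Th) {T : Set Expr} (hT : T ∈ Th)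
    {a : Expr} (ha : a ∉ T) : ∃ M, T ⊆ M ∧ TotallyPrimeTheory Th M ∧ a ∉ M := by
  obtain ⟨M, hTM, hM, haM, hmax⟩ := hC.exists_maximal (fun U => a ∉ U)
    (fun 𝒞 h𝒞 _ _ ⟨U, hU, haU⟩ => (h𝒞 hU).2 haU) hT ha
  refine ⟨M, hTM, ⟨hM, fun 𝒯 h𝒯 _ h => ?_⟩, haM⟩
  have ha' : a ∉ ⋂₀ 𝒯 := h ▸ haM
  simp only [Set.mem_sInter, not_forall] at ha'
  obtain ⟨U, hU, haU⟩ := ha'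
  rwa [hmax U (h𝒯 hU) haU (h ▸ Set.sInter_subset_of_mem hU)]

namespace IsDistributiveLogic

theorem wedge_mem_iff (hD : IsDistributiveLogic Th vee wedge) {T : Set Expr} (hT : T ∈ Th)
    {a b : Expr} : wedge a b ∈ T ↔ a ∈ T ∧ b ∈ T := by
  obtain ⟨-, hC, -, hw⟩ := hD
  refine ⟨fun h => ⟨?_, ?_⟩, fun h => ?_⟩ <;> by_contra hn <;>
    obtain ⟨M, hTM, hM, hnM⟩ := hC.exists_totallyPrimeTheory hT hn
  · exact hnM ((hw M hM a b).1 (hTM h)).1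
  · exact hnM ((hw M hM a b).1 (hTM h)).2
  · exact hnM ((hw M hM a b).2 ⟨hTM h.1, hTM h.2⟩)

theorem vee_mem (hD : IsDistributiveLogic Th vee wedge) {T : Set Expr} (hT : T ∈ Th)
    {a b : Expr} (h : a ∈ T ∨ b ∈ T) : vee a b ∈ T := by
  by_contra hn
  obtain ⟨M, hTM, hM, hnM⟩ := hD.2.1.exists_totallyPrimeTheory hT hn
  exact hnM ((hD.2.2.1 M hM a b).2 (h.imp (@hTM a) (@hTM b)))

theorem vee_mem_iff (hD : IsDistributiveLogic Th vee wedge) {P : Set Expr}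
    (hP : PrimeTheory Th P) {a b : Expr} : vee a b ∈ P ↔ a ∈ P ∨ b ∈ P := by
  refine ⟨fun h => ?_, hD.vee_mem hP.1⟩
  by_contra! hn
  obtain ⟨ha, hb⟩ := hn
  let above (c : Expr) : Set (Set Expr) := {T | T ∈ Th ∧ P ⊆ T ∧ c ∈ T}
  have mem_above {M : Set Expr} (hM : TotallyPrimeTheory Th M) (hPM : P ⊆ M) :
      M ∈ above a ∨ M ∈ above b :=
    ((hD.2.2.1 M hM a b).1 (hPM h)).imp (⟨hM.1, hPM, ·⟩) (⟨hM.1, hPM, ·⟩)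
  have hna : (above a).Nonempty := by
    obtain ⟨M, hPM, hM, hbM⟩ := hD.2.1.exists_totallyPrimeTheory hP.1 hb
    exact ⟨M, (mem_above hM hPM).resolve_right fun h => hbM h.2.2⟩
  have hnb : (above b).Nonempty := by
    obtain ⟨M, hPM, hM, haM⟩ := hD.2.1.exists_totallyPrimeTheory hP.1 ha
    exact ⟨M, (mem_above hM hPM).resolve_left fun h => haM h.2.2⟩
  have key : P = ⋂₀ above a ∩ ⋂₀ above b := by
    apply Set.Subset.antisymm
    · exact fun x hx => ⟨fun T hT => hT.2.1 hx, fun T hT => hT.2.1 hx⟩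
    · rintro x ⟨hxa, hxb⟩
      by_contra hx
      obtain ⟨M, hPM, hM, hxM⟩ := hD.2.1.exists_totallyPrimeTheory hP.1 hx
      exact hxM ((mem_above hM hPM).elim (hxa M) (hxb M))
  rcases hP.2 _ (hD.1.2 _ (fun T hT => hT.1) hna) _ (hD.1.2 _ (fun T hT => hT.1) hnb) key
    with h' | h'
  · exact ha (h' ▸ fun T hT => hT.2.2)
  · exact hb (h' ▸ fun T hT => hT.2.2)

theorem basicSet_wedge (hD : IsDistributiveLogic Th vee wedge) (a b : Expr) :
    basicSet Th (wedge a b) = basicSet Th a ∩ basicSet Th b :=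
  Set.ext fun P => hD.wedge_mem_iff P.prime.1

theorem basicSet_vee (hD : IsDistributiveLogic Th vee wedge) (a b : Expr) :
    basicSet Th (vee a b) = basicSet Th a ∪ basicSet Th b :=
  Set.ext fun P => hD.vee_mem_iff P.prime

/-- A nonempty set closed under conjunction and single-premise consequence extends, for each
expression outside it, to a theory omitting that expression. -/
theorem exists_theory_extending (hD : IsDistributiveLogic Th vee wedge) {S : Set Expr}
    (hne : S.Nonempty) (hw : ∀ a ∈ S, ∀ b ∈ S, wedge a b ∈ S) {c : Expr}
    (hsep : ∀ a ∈ S, ∃ T ∈ Th, a ∈ T ∧ c ∉ T) : ∃ M ∈ Th, S ⊆ M ∧ c ∉ M := by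
  obtain ⟨⟨hTh, hInter⟩, hC, -⟩ := id hD
  let good (T : Set Expr) : Prop := ∀ a ∈ S, ∃ U ∈ Th, T ⊆ U ∧ a ∈ U ∧ c ∉ U
  have hchain : ∀ 𝒞 ⊆ {T | T ∈ Th ∧ good T}, 𝒞.Nonempty → IsChain (· ⊆ ·) 𝒞 →
      good (⋃₀ 𝒞) := by
    intro 𝒞 h𝒞 hne𝒞 hc a ha
    let cl (T : Set Expr) : Set Expr := ⋂₀ {U | U ∈ Th ∧ T ⊆ U ∧ a ∈ U}
    have hcl : Monotone cl := fun T T' h =>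
      Set.sInter_subset_sInter fun U hU => ⟨hU.1, h.trans hU.2.1, hU.2.2⟩
    refine ⟨⋃₀ (cl '' 𝒞), hC _ ?_ (hne𝒞.image cl) ?_, ?_, ?_, ?_⟩
    · rintro _ ⟨T, hT, rfl⟩
      obtain ⟨U, hU, hTU, haU, -⟩ := (h𝒞 hT).2 a ha
      exact hInter _ (fun V hV => hV.1) ⟨U, hU, hTU, haU⟩
    · rintro _ ⟨T, hT, rfl⟩ _ ⟨T', hT', rfl⟩ -
      exact (hc.total hT hT').imp (fun h => hcl h) (fun h => hcl h)
    · exact Set.sUnion_subset fun T hT x hx =>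
        ⟨cl T, Set.mem_image_of_mem cl hT, fun U hU => hU.2.1 hx⟩
    · obtain ⟨T, hT⟩ := hne𝒞
      exact ⟨cl T, Set.mem_image_of_mem cl hT, fun U hU => hU.2.2⟩
    · rintro ⟨_, ⟨T, hT, rfl⟩, hcT⟩
      obtain ⟨U, hU, hTU, haU, hcU⟩ := (h𝒞 hT).2 a ha
      exact hcU (hcT U ⟨hU, hTU, haU⟩)
  obtain ⟨M, -, hM, hgood, hmax⟩ := hC.exists_maximal good hchain
    (hInter Th subset_rfl hTh)
    (fun a ha => (hsep a ha).imp fun T hT => ⟨hT.1, Set.sInter_subset_of_mem hT.1, hT.2⟩)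
  refine ⟨M, hM, fun s hs => ?_, ?_⟩
  · let N : Set Expr := ⋂₀ {U | U ∈ Th ∧ M ⊆ U ∧ s ∈ U}
    have hN : N ∈ Th := by
      obtain ⟨U, hU, hMU, hsU, -⟩ := hgood s hs
      exact hInter _ (fun T hT => hT.1) ⟨U, hU, hMU, hsU⟩
    have hMN : M = N := by
      refine hmax N hN (fun a ha => ?_) fun x hx T hT => hT.2.1 hx
      obtain ⟨U, hU, hMU, hasU, hcU⟩ := hgood _ (hw a ha s hs)
      have hasU' := (hD.wedge_mem_iff hU).1 hasU
      exact ⟨U, hU, Set.sInter_subset_of_mem ⟨hU, hMU, hasU'.2⟩, hasU'.1, hcU⟩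
    exact hMN ▸ fun T hT => hT.2.2
  · obtain ⟨a, ha⟩ := hne
    obtain ⟨U, -, hMU, -, hcU⟩ := hgood a ha
    exact fun h => hcU (hMU h)

theorem primeTheory_preimage (hD : IsDistributiveLogic Th vee wedge)
    (hincons : ∃ b : Expr, ∀ T ∈ Th, b ∉ T) {F : Set (Set (LogicSpace Th))}
    (hF : IsPrimeFilter (Set.range (basicSet Th)) F) :
    PrimeTheory Th (basicSet Th ⁻¹' F) := by
  obtain ⟨hne, hsub, hempty, hup, hinter, hunion⟩ := hF
  have hS : (basicSet Th ⁻¹' F).Nonempty := by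
    obtain ⟨U, hU⟩ := hne
    obtain ⟨a, rfl⟩ := hsub hU
    exact ⟨a, hU⟩
  have hext {c : Expr} (hcF : c ∉ basicSet Th ⁻¹' F) :
      ∃ M ∈ Th, basicSet Th ⁻¹' F ⊆ M ∧ c ∉ M := by
    refine hD.exists_theory_extending hS
      (fun a ha b hb => by simpa [hD.basicSet_wedge] using hinter _ ha _ hb) fun a ha => ?_
    by_contra! h
    exact hcF (hup _ ha _ ⟨c, rfl⟩ fun P hP => h P.val P.prime.1 hP)
  have hmem : basicSet Th ⁻¹' F ∈ Th := by
    have heq : basicSet Th ⁻¹' F = ⋂₀ {M | M ∈ Th ∧ basicSet Th ⁻¹' F ⊆ M} := by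
      refine Set.Subset.antisymm (fun x hx M hM => hM.2 hx) fun x hx => ?_
      by_contra hn
      obtain ⟨M, hM, hSM, hxM⟩ := hext hn
      exact hxM (hx M ⟨hM, hSM⟩)
    obtain ⟨b, hb⟩ := hincons
    have hbF : b ∉ basicSet Th ⁻¹' F := by
      have : basicSet Th b = ∅ := Set.eq_empty_of_forall_notMem fun P => hb P.val P.prime.1
      rwa [Set.mem_preimage, this]
    obtain ⟨M, hM, hSM, -⟩ := hext hbF
    rw [heq]
    exact hD.1.2 _ (fun T hT => hT.1) ⟨M, hM, hSM⟩
  refine ⟨hmem, fun T₁ h₁ T₂ h₂ h => ?_⟩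
  by_contra! hn
  have hx : ¬ T₁ ⊆ basicSet Th ⁻¹' F :=
    fun hs => hn.1 ((h.trans_subset Set.inter_subset_left).antisymm hs)
  have hy : ¬ T₂ ⊆ basicSet Th ⁻¹' F :=
    fun hs => hn.2 ((h.trans_subset Set.inter_subset_right).antisymm hs)
  obtain ⟨x, hx₁, hxF⟩ := Set.not_subset.1 hx
  obtain ⟨y, hy₂, hyF⟩ := Set.not_subset.1 hy
  have hxy : vee x y ∈ basicSet Th ⁻¹' F :=
    h ▸ ⟨hD.vee_mem h₁ (Or.inl hx₁), hD.vee_mem h₂ (Or.inr hy₂)⟩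
  rw [Set.mem_preimage, hD.basicSet_vee] at hxy
  exact (hunion _ ⟨x, rfl⟩ _ ⟨y, rfl⟩ hxy).elim hxF hyF

theorem isPrimeFilter_point (hD : IsDistributiveLogic Th vee wedge)
    (hvalid : ∃ a : Expr, ∀ T ∈ Th, a ∈ T) (P : LogicSpace Th) :
    IsPrimeFilter (Set.range (basicSet Th)) {U ∈ Set.range (basicSet Th) | P ∈ U} := by
  obtain ⟨a, ha⟩ := hvalid
  refine ⟨⟨basicSet Th a, ⟨a, rfl⟩, ha _ P.prime.1⟩, fun U hU => hU.1, fun h => h.2,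
    fun U hU V hV h => ⟨hV, h hU.2⟩, ?_, fun U hU V hV h => h.2.imp (⟨hU, ·⟩) (⟨hV, ·⟩)⟩
  rintro _ ⟨⟨b, rfl⟩, hb⟩ _ ⟨⟨c, rfl⟩, hc⟩
  exact ⟨⟨wedge b c, hD.basicSet_wedge b c⟩, hb, hc⟩

end IsDistributiveLogic

theorem preimage_basicSet_point (P : LogicSpace Th) :
    basicSet Th ⁻¹' {U ∈ Set.range (basicSet Th) | P ∈ U} = P.val :=
  Set.ext fun a => ⟨fun h => h.2, fun h => ⟨⟨a, rfl⟩, h⟩⟩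

theorem subset_range_of_mem_primeFilterTheories {T : Set (Set (LogicSpace Th))}
    (hT : T ∈ primeFilterTheories Th) : T ⊆ Set.range (basicSet Th) := by
  obtain ⟨𝒬, ⟨F, hF⟩, h𝒬, rfl⟩ := hT
  exact (Set.sInter_subset_of_mem hF).trans (h𝒬 F hF).2.1

theorem logEquiv_iff_basicSet_eq (hC : ChainClosed Th) (a b : Expr) :
    LogEquiv Th a b ↔ basicSet Th a = basicSet Th b := by
  refine ⟨fun h => Set.ext fun P => h P.val P.prime.1, fun h T hT => ?_⟩
  have mem_of {c d : Expr} (hcd : basicSet Th c = basicSet Th d) (hc : c ∈ T) : d ∈ T := by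
    by_contra hd
    obtain ⟨M, hTM, hM, hdM⟩ := hC.exists_totallyPrimeTheory hT hd
    have hcM : (⟨M, hM.primeTheory⟩ : LogicSpace Th) ∈ basicSet Th c := hTM hc
    exact hdM (hcd ▸ hcM :)
  exact ⟨mem_of h, mem_of h.symm⟩

namespace IsDistributiveLogic

theorem preimage_mem (hD : IsDistributiveLogic Th vee wedge)
    (hincons : ∃ b : Expr, ∀ T ∈ Th, b ∉ T) {T : Set (Set (LogicSpace Th))}
    (hT : T ∈ primeFilterTheories Th) : basicSet Th ⁻¹' T ∈ Th := by
  obtain ⟨𝒬, hne, h𝒬, rfl⟩ := hT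
  rw [Set.preimage_sInter, ← Set.sInter_image]
  refine hD.1.2 _ ?_ (hne.image _)
  rintro _ ⟨F, hF, rfl⟩
  exact (hD.primeTheory_preimage hincons (h𝒬 F hF)).1

theorem exists_preimage_eq (hD : IsDistributiveLogic Th vee wedge)
    (hvalid : ∃ a : Expr, ∀ T ∈ Th, a ∈ T) (hincons : ∃ b : Expr, ∀ T ∈ Th, b ∉ T)
    {T : Set Expr} (hT : T ∈ Th) : ∃ T' ∈ primeFilterTheories Th, T = basicSet Th ⁻¹' T' := by
  let point (P : LogicSpace Th) : Set (Set (LogicSpace Th)) :=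
    {U ∈ Set.range (basicSet Th) | P ∈ U}
  refine ⟨_, ⟨point '' {P | T ⊆ P.val}, ?_, ?_, rfl⟩, ?_⟩
  · obtain ⟨b, hb⟩ := hincons
    obtain ⟨M, hTM, hM, -⟩ := hD.2.1.exists_totallyPrimeTheory hT (hb T hT)
    exact ⟨_, Set.mem_image_of_mem point
      (show (⟨M, hM.primeTheory⟩ : LogicSpace Th) ∈ {P | T ⊆ P.val} from hTM)⟩
  · rintro _ ⟨P, -, rfl⟩
    exact hD.isPrimeFilter_point hvalid P
  · refine Set.Subset.antisymm ?_ fun x hx => ?_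
    · rintro x hx _ ⟨P, hP, rfl⟩
      exact ⟨⟨x, rfl⟩, hP hx⟩
    · by_contra hn
      obtain ⟨M, hTM, hM, hxM⟩ := hD.2.1.exists_totallyPrimeTheory hT hn
      exact hxM (hx _ (Set.mem_image_of_mem point
        (show (⟨M, hM.primeTheory⟩ : LogicSpace Th) ∈ {P | T ⊆ P.val} from hTM))).2

theorem stable_basicSet (hD : IsDistributiveLogic Th vee wedge)
    (hvalid : ∃ a : Expr, ∀ T ∈ Th, a ∈ T) (hincons : ∃ b : Expr, ∀ T ∈ Th, b ∉ T)
    {P : Set (Set (LogicSpace Th))} (hP : PrimeTheory (primeFilterTheories Th) P) :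
    PrimeTheory Th (basicSet Th ⁻¹' P) := by
  refine ⟨hD.preimage_mem hincons hP.1, fun T₁ h₁ T₂ h₂ h => ?_⟩
  obtain ⟨T₁', h₁', rfl⟩ := hD.exists_preimage_eq hvalid hincons h₁
  obtain ⟨T₂', h₂', rfl⟩ := hD.exists_preimage_eq hvalid hincons h₂
  have heq : P = T₁' ∩ T₂' :=
    (Set.preimage_eq_preimage' (subset_range_of_mem_primeFilterTheories hP.1)
      (Set.inter_subset_left.trans (subset_range_of_mem_primeFilterTheories h₁'))).1 h
  exact (hP.2 _ h₁' _ h₂' heq).imp (congrArg _) (congrArg _)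

end IsDistributiveLogic

end

/-- For a bounded distributive abstract logic `ℒ` with space
`X = PTh` and `τ(a) = a^X`: (1) `a` and `b` are logically equivalent iff
`a^X = b^X`; (2) the preimages under `τ` of the prime filters on `Λ(X)` are
exactly the prime theories of `ℒ`; consequently `τ` is a normal and stable
logic map from `ℒ` to the logic `ℒ'` on `Λ(X)` (whose theories are the
nonempty intersections of prime filters on `Λ(X)`) which is surjective onto
`Λ(X)`, i.e. a logic isomorphism. -/
theorem tau_logic_isomorphism {Expr : Type*} (Th : Set (Set Expr))
    (vee wedge : Expr → Expr → Expr) (hD : IsDistributiveLogic Th vee wedge)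
    (hvalid : ∃ a : Expr, ∀ T ∈ Th, a ∈ T)
    (hincons : ∃ b : Expr, ∀ T ∈ Th, b ∉ T) :
    (∀ a b : Expr, LogEquiv Th a b ↔ basicSet Th a = basicSet Th b) ∧
    ({S : Set Expr | ∃ F : Set (Set (LogicSpace Th)),
        IsPrimeFilter (Set.range (basicSet Th)) F ∧ S = basicSet Th ⁻¹' F}
      = {P : Set Expr | PrimeTheory Th P}) ∧
    (∀ T' ∈ primeFilterTheories Th, basicSet Th ⁻¹' T' ∈ Th) ∧
    ({S : Set Expr | ∃ T' ∈ primeFilterTheories Th, S = basicSet Th ⁻¹' T'} = Th) ∧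
    (∀ P', PrimeTheory (primeFilterTheories Th) P' →
      PrimeTheory Th (basicSet Th ⁻¹' P')) ∧
    (∀ U ∈ Set.range (basicSet Th), ∃ a : Expr, basicSet Th a = U) := by
  refine ⟨logEquiv_iff_basicSet_eq hD.2.1, ?_, fun T' hT' => hD.preimage_mem hincons hT', ?_,
    fun P' hP' => hD.stable_basicSet hvalid hincons hP', fun U hU => hU⟩
  · refine Set.Subset.antisymm ?_ fun P hP =>
      ⟨_, hD.isPrimeFilter_point hvalid ⟨P, hP⟩, (preimage_basicSet_point ⟨P, hP⟩).symm⟩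
    rintro _ ⟨F, hF, rfl⟩
    exact hD.primeTheory_preimage hincons hF
  · refine Set.Subset.antisymm ?_ fun T hT => hD.exists_preimage_eq hvalid hincons hT
    rintro _ ⟨T', hT', rfl⟩
    exact hD.preimage_mem hincons hT'
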